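/- Let (Q_1, ..., Q_n), with n ≥ 1, be a decomposition of a query graph Q such that each Q_i is a subject-object star query (so-query), and let (G_1, ..., G_m), with m ≥ 1, be the s-decomposition of a data graph G determined by a partition (N_1, ..., N_m) of N(G) − L. Then e is a total embedding of Q in G if and only if e is the join of mutually compatible embeddings e_1, ..., e_n such that, for each i with 1 ≤ i ≤ n, e_i is a total embedding of Q_i in some segment G_j with 1 ≤ j ≤ m. -/

import Mathlib

namespace RDF

variable {α β : Type*}

/-- The nodes (subjects and objects) of a set of triples. -/
def Nodes (F : Set (α × β × α)) : Set α :=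
  {v | (∃ p o, (v, p, o) ∈ F) ∨ (∃ s p, (s, p, v) ∈ F)}

/-- The background setting: `Uso` (URI references used as subjects/objects), `L` (literals)
and `V` (variables) are countably infinite and pairwise disjoint subsets of `α`;
the predicate URIs form the (separate) type `β`. -/
def Setting (Uso L V : Set α) : Prop :=
  Uso.Countable ∧ Uso.Infinite ∧ L.Countable ∧ L.Infinite ∧ V.Countable ∧ V.Infinite ∧
    Disjoint Uso L ∧ Disjoint Uso V ∧ Disjoint L V

/-- `G` is a data graph: a nonempty set of data triples. -/
def IsDataGraph (Uso L : Set α) (G : Set (α × β × α)) : Prop :=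
  G.Nonempty ∧ ∀ t ∈ G, t.1 ∈ Uso ∧ t.2.2 ∈ Uso ∪ L

/-- `Q` is a query graph: a nonempty set of query triples. -/
def IsQueryGraph (Uso L V : Set α) (Q : Set (α × β × α)) : Prop :=
  Q.Nonempty ∧ ∀ t ∈ Q, t.1 ∈ Uso ∪ V ∧ t.2.2 ∈ Uso ∪ L ∪ V

/-- Partial mappings are modeled as functions `α → Option α`.  A total embedding of `Q`
in `G` is defined exactly on the nodes of `Q`, takes values in the nodes of `G`,
is the identity on non-variables, and maps every triple of `Q` to a triple of `G`. -/
def IsTotalEmbedding (V : Set α) (Q G : Set (α × β × α)) (e : α → Option α) : Prop :=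
  (∀ v, (e v).isSome ↔ v ∈ Nodes Q) ∧
    (∀ v a, e v = some a → a ∈ Nodes G) ∧
    (∀ v ∈ Nodes Q, v ∉ V → e v = some v) ∧
    (∀ s p o, (s, p, o) ∈ Q → ∃ s' o', e s = some s' ∧ e o = some o' ∧ (s', p, o') ∈ G)

/-- A partial embedding of `Q` in `G`. -/
def IsPartialEmbedding (V : Set α) (Q G : Set (α × β × α)) (e : α → Option α) : Prop :=
  (∀ v, (e v).isSome → v ∈ Nodes Q) ∧
    (∀ v a, e v = some a → a ∈ Nodes G) ∧
    (∀ v a, e v = some a → v ∉ V → a = v) ∧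
    (∀ v a, e v = some a → v ∈ V →
      ∃ u u' p, e u = some u' ∧
        (((v, p, u) ∈ Q ∧ (a, p, u') ∈ G) ∨ ((u, p, v) ∈ Q ∧ (u', p, a) ∈ G)))

/-- A partial embedding is non-trivial if it maps at least one triple of `Q` into `G`. -/
def NonTrivial (Q G : Set (α × β × α)) (e : α → Option α) : Prop :=
  ∃ v₁ p v₂ a b, (v₁, p, v₂) ∈ Q ∧ e v₁ = some a ∧ e v₂ = some b ∧ (a, p, b) ∈ G

/-- Two partial mappings are compatible if they agree wherever both are defined. -/
def Compatible (e₁ e₂ : α → Option α) : Prop :=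
  ∀ v a b, e₁ v = some a → e₂ v = some b → a = b

/-- The join of two partial mappings (the first takes precedence where defined). -/
def join (e₁ e₂ : α → Option α) : α → Option α :=
  fun v => (e₁ v).elim (e₂ v) some

/-- `e` is the join of the mutually compatible family `f` of partial mappings:
`e` is defined at `v` with value `a` iff some member of the family is. -/
def IsJoin {ι : Type*} (f : ι → α → Option α) (e : α → Option α) : Prop :=
  ∀ v a, e v = some a ↔ ∃ i, f i v = some a

/-- `seg` is a decomposition of the graph `F` into (nonempty) segments. -/
def IsDecomposition {m : ℕ} (F : Set (α × β × α)) (seg : Fin m → Set (α × β × α)) : Prop :=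
  (∀ i, (seg i).Nonempty) ∧ (∀ i, seg i ⊆ F) ∧ (⋃ i, seg i) = F

/-- A decomposition is non-redundant if its segments are pairwise disjoint. -/
def NonRedundant {m : ℕ} (seg : Fin m → Set (α × β × α)) : Prop :=
  ∀ i j, i ≠ j → seg i ∩ seg j = ∅

/-- Border nodes of two segments. -/
def BorderPair (L : Set α) (F₁ F₂ : Set (α × β × α)) : Set α :=
  (Nodes F₁ ∩ Nodes F₂) \ L

/-- Border nodes of segment `i` of a decomposition. -/
def Border {m : ℕ} (L : Set α) (seg : Fin m → Set (α × β × α)) (i : Fin m) : Set α :=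
  ⋃ j ∈ {j : Fin m | j ≠ i}, BorderPair L (seg i) (seg j)

/-- Useful partial embedding of `Q` in the segment `seg i` of a decomposition. -/
def IsUseful {m : ℕ} (V L : Set α) (Q : Set (α × β × α))
    (seg : Fin m → Set (α × β × α)) (i : Fin m) (e : α → Option α) : Prop :=
  IsPartialEmbedding V Q (seg i) e ∧
    NonTrivial Q (seg i) e ∧
    (∀ v ∈ Nodes Q ∩ Nodes (seg i), (e v).isSome) ∧
    (∀ v p u a, (v, p, u) ∈ Q → e v = some a → a ∉ Border L seg i ∪ L →
      ∃ b, e u = some b ∧ (a, p, b) ∈ seg i) ∧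
    (∀ v p u b, (v, p, u) ∈ Q → e u = some b → b ∉ Border L seg i ∪ L →
      ∃ a, e v = some a ∧ (a, p, b) ∈ seg i)

/-- Generalized star query with central node `c`. -/
def IsGenStar (Q : Set (α × β × α)) (c : α) : Prop :=
  c ∈ Nodes Q ∧ ∀ t ∈ Q, t.1 = c ∨ t.2.2 = c

/-- Subject-object star query (so-query) with central node `c`. -/
def IsSOStar (Q : Set (α × β × α)) (c : α) : Prop :=
  IsGenStar Q c ∧ ∃ t ∈ Q, t.1 = c

/-- `W` is a node cover of `Q`. -/
def IsNodeCover (L : Set α) (Q : Set (α × β × α)) (W : Set α) : Prop :=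
  W ⊆ Nodes Q \ L ∧ ∀ t ∈ Q, t.1 ∈ W ∨ t.2.2 ∈ W

/-- `N` is a partition (into nonempty blocks) of the non-literal nodes of `G`. -/
def IsPartitionOfNodes {m : ℕ} (L : Set α) (G : Set (α × β × α)) (N : Fin m → Set α) : Prop :=
  (∀ i, (N i).Nonempty) ∧ (⋃ i, N i) = Nodes G \ L ∧ ∀ i j, i ≠ j → N i ∩ N j = ∅

/-- The `i`-th segment of the s-decomposition of `G` determined by the node partition `N`. -/
def sSeg {m : ℕ} (G : Set (α × β × α)) (N : Fin m → Set α) (i : Fin m) : Set (α × β × α) :=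
  {t | t ∈ G ∧ (t.1 ∈ N i ∨ t.2.2 ∈ N i)}

/-- Replicated node of the `i`-th s-segment. -/
def ReplicatedNode {m : ℕ} (L : Set α) (G : Set (α × β × α)) (N : Fin m → Set α)
    (i : Fin m) (v : α) : Prop :=
  v ∈ Nodes (sSeg G N i) ∧ v ∉ L ∧ v ∉ N i

/-- Replicated triple of the `i`-th s-segment. -/
def ReplicatedTriple {m : ℕ} (L : Set α) (G : Set (α × β × α)) (N : Fin m → Set α)
    (i : Fin m) (t : α × β × α) : Prop :=
  t ∈ sSeg G N i ∧ (ReplicatedNode L G N i t.1 ∨ ReplicatedNode L G N i t.2.2)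

open Classical in
/-- Restriction of a partial mapping to a set. -/
noncomputable def restrictTo (S : Set α) (e : α → Option α) : α → Option α :=
  fun v => if v ∈ S then e v else none

/-- The answer determined by an embedding: its restriction to the variables. -/
noncomputable def answerOf (V : Set α) (e : α → Option α) : α → Option α :=
  restrictTo V e

/-- The set of answers of `Q` over `G`. -/
def Answers (V : Set α) (Q G : Set (α × β × α)) : Set (α → Option α) :=
  {a | ∃ e, IsTotalEmbedding V Q G e ∧ a = answerOf V e}

theorem Nodes.subject {F : Set (α × β × α)} {s : α} {p : β} {o : α} (h : (s, p, o) ∈ F) :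
    s ∈ Nodes F :=
  Or.inl ⟨p, o, h⟩

theorem Nodes.object {F : Set (α × β × α)} {s : α} {p : β} {o : α} (h : (s, p, o) ∈ F) :
    o ∈ Nodes F :=
  Or.inr ⟨s, p, h⟩

theorem Nodes.mono {F F' : Set (α × β × α)} (h : F ⊆ F') : Nodes F ⊆ Nodes F' := by
  rintro v (⟨p, o, hv⟩ | ⟨s, p, hv⟩)
  · exact .subject (h hv)
  · exact .object (h hv)

theorem sSeg_subset {m : ℕ} (G : Set (α × β × α)) (N : Fin m → Set α) (i : Fin m) :
    sSeg G N i ⊆ G :=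
  fun _ h => h.1

theorem IsDecomposition.exists_mem {m : ℕ} {F : Set (α × β × α)}
    {seg : Fin m → Set (α × β × α)} (h : IsDecomposition F seg) {t : α × β × α} (ht : t ∈ F) :
    ∃ i, t ∈ seg i :=
  Set.mem_iUnion.1 (h.2.2.symm ▸ ht)

theorem IsDecomposition.mem_nodes_iff {m : ℕ} {F : Set (α × β × α)}
    {seg : Fin m → Set (α × β × α)} (h : IsDecomposition F seg) {v : α} :
    v ∈ Nodes F ↔ ∃ i, v ∈ Nodes (seg i) := by
  constructor
  · rintro (⟨p, o, hv⟩ | ⟨s, p, hv⟩)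
    · exact (h.exists_mem hv).imp fun _ hi => .subject hi
    · exact (h.exists_mem hv).imp fun _ hi => .object hi
  · rintro ⟨i, hi⟩
    exact Nodes.mono (h.2.1 i) hi

theorem restrictTo_of_mem {S : Set α} {v : α} (h : v ∈ S) (e : α → Option α) :
    restrictTo S e v = e v :=
  if_pos h

theorem restrictTo_eq_some {S : Set α} {e : α → Option α} {v a : α} :
    restrictTo S e v = some a ↔ v ∈ S ∧ e v = some a := by
  by_cases h : v ∈ S <;> simp [restrictTo, h]

theorem IsPartitionOfNodes.exists_subject_mem {m : ℕ} {Uso L : Set α} (hUL : Disjoint Uso L)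
    {G : Set (α × β × α)} (hG : IsDataGraph Uso L G) {N : Fin m → Set α}
    (hN : IsPartitionOfNodes L G N) {s : α} {p : β} {o : α} (h : (s, p, o) ∈ G) :
    ∃ j, s ∈ N j :=
  Set.mem_iUnion.1 <| hN.2.1.symm ▸
    ⟨Nodes.subject h, Set.disjoint_left.1 hUL (hG.2 _ h).1⟩

/-- Restricting an embedding to a subquery gives an embedding in any segment that contains the
images of the triples of the subquery. -/
theorem IsTotalEmbedding.restrictTo {V : Set α} {Q Q' G G' : Set (α × β × α)}
    {e : α → Option α} (he : IsTotalEmbedding V Q G e) (hQ : Q' ⊆ Q)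
    (hG : ∀ s p o, (s, p, o) ∈ Q' → ∀ s' o', e s = some s' → e o = some o' →
      (s', p, o') ∈ G → (s', p, o') ∈ G') :
    IsTotalEmbedding V Q' G' (restrictTo (Nodes Q') e) := by
  have key : ∀ s p o, (s, p, o) ∈ Q' →
      ∃ s' o', e s = some s' ∧ e o = some o' ∧ (s', p, o') ∈ G' := fun s p o h => by
    obtain ⟨s', o', hs, ho, hst⟩ := he.2.2.2 s p o (hQ h)
    exact ⟨s', o', hs, ho, hG s p o h s' o' hs ho hst⟩
  refine ⟨fun v => ?_, fun v a h => ?_, fun v hv hV => ?_, fun s p o h => ?_⟩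
  · rw [Option.isSome_iff_exists]
    simp only [restrictTo_eq_some, exists_and_left, and_iff_left_iff_imp]
    exact fun hv => Option.isSome_iff_exists.1 ((he.1 v).2 (Nodes.mono hQ hv))
  · obtain ⟨hv, ha⟩ := restrictTo_eq_some.1 h
    rcases hv with ⟨p, o, hv⟩ | ⟨s, p, hv⟩
    · obtain ⟨s', o', hs, -, hst⟩ := key _ _ _ hv
      obtain rfl : s' = a := Option.some.inj (hs.symm.trans ha)
      exact .subject hst
    · obtain ⟨s', o', -, ho, hst⟩ := key _ _ _ hv
      obtain rfl : o' = a := Option.some.inj (ho.symm.trans ha)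
      exact .object hst
  · exact (restrictTo_of_mem hv e).trans (he.2.2.1 v (Nodes.mono hQ hv) hV)
  · obtain ⟨s', o', hs, ho, hst⟩ := key s p o h
    exact ⟨s', o', (restrictTo_of_mem (.subject h) e).trans hs,
      (restrictTo_of_mem (.object h) e).trans ho, hst⟩

/-- A total embedding of an so-query restricts to one in a single s-segment. -/
theorem IsTotalEmbedding.exists_sSeg {m : ℕ} {Uso L V : Set α} (hUL : Disjoint Uso L)
    {Q Q' G : Set (α × β × α)} (hG : IsDataGraph Uso L G) {N : Fin m → Set α}
    (hN : IsPartitionOfNodes L G N) {e : α → Option α} (he : IsTotalEmbedding V Q G e)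
    (hQ : Q' ⊆ Q) {c : α} (hc : IsSOStar Q' c) :
    ∃ j, IsTotalEmbedding V Q' (sSeg G N j) (RDF.restrictTo (Nodes Q') e) := by
  obtain ⟨⟨-, hstar⟩, ⟨s, p, o⟩, ht, rfl⟩ := hc
  obtain ⟨c', o', hc', -, hst⟩ := he.2.2.2 s p o (hQ ht)
  obtain ⟨j, hj⟩ := hN.exists_subject_mem hUL hG hst
  refine ⟨j, he.restrictTo hQ fun x q y hxy x' y' hx hy hG' => ⟨hG', ?_⟩⟩
  rcases hstar _ hxy with h | h <;> dsimp only at h <;> subst h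
  · exact Or.inl (Option.some.inj (hx.symm.trans hc') ▸ hj)
  · exact Or.inr (Option.some.inj (hy.symm.trans hc') ▸ hj)

/-- A join of total embeddings of the members of a decomposition is a total embedding. -/
theorem IsTotalEmbedding.of_isJoin {n : ℕ} {V : Set α} {Q G : Set (α × β × α)}
    {Qs : Fin n → Set (α × β × α)} (hQs : IsDecomposition Q Qs) {e : α → Option α}
    {f : Fin n → α → Option α} {Gs : Fin n → Set (α × β × α)} (hGs : ∀ i, Gs i ⊆ G)
    (hf : ∀ i, IsTotalEmbedding V (Qs i) (Gs i) (f i)) (he : IsJoin f e) :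
    IsTotalEmbedding V Q G e := by
  refine ⟨fun v => ?_, fun v a h => ?_, fun v hv hV => ?_, fun s p o h => ?_⟩
  · rw [hQs.mem_nodes_iff, Option.isSome_iff_exists]
    simp only [he v, ← (hf _).1 v, Option.isSome_iff_exists]
    exact exists_comm
  · obtain ⟨i, hi⟩ := (he v a).1 h
    exact Nodes.mono (hGs i) ((hf i).2.1 v a hi)
  · obtain ⟨i, hi⟩ := hQs.mem_nodes_iff.1 hv
    exact (he v v).2 ⟨i, (hf i).2.2.1 v hi hV⟩
  · obtain ⟨i, hi⟩ := hQs.exists_mem h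
    obtain ⟨s', o', hs, ho, hst⟩ := (hf i).2.2.2 s p o hi
    exact ⟨s', o', (he _ _).2 ⟨i, hs⟩, (he _ _).2 ⟨i, ho⟩, hGs i hst⟩

/-- Theorem: embeddings of `Q` in `G` are exactly the joins of
mutually compatible total embeddings of the so-subqueries, each computed in a
single segment of the s-decomposition. -/
theorem statement11 {α β : Type*} [Countable β] [Infinite β]
    {Uso L V : Set α} (hset : Setting Uso L V)
    {Q : Set (α × β × α)} (hQ : IsQueryGraph Uso L V Q)
    {n : ℕ} (hn : 1 ≤ n)
    {Qs : Fin n → Set (α × β × α)} (hQs : IsDecomposition Q Qs)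
    (hso : ∀ i, ∃ c, IsSOStar (Qs i) c)
    {G : Set (α × β × α)} (hG : IsDataGraph Uso L G)
    {m : ℕ} (hm : 1 ≤ m)
    {N : Fin m → Set α} (hN : IsPartitionOfNodes L G N)
    (e : α → Option α) :
    IsTotalEmbedding V Q G e ↔
      ∃ f : Fin n → α → Option α,
        (∀ i j, Compatible (f i) (f j)) ∧
        (∀ i, ∃ j : Fin m, IsTotalEmbedding V (Qs i) (sSeg G N j) (f i)) ∧
        IsJoin f e := by
  constructor
  · intro he
    refine ⟨fun i => restrictTo (Nodes (Qs i)) e, fun i j v a b ha hb => ?_, fun i => ?_,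
      fun v a => ?_⟩
    · exact Option.some.inj
        ((restrictTo_eq_some.1 ha).2.symm.trans (restrictTo_eq_some.1 hb).2)
    · obtain ⟨c, hc⟩ := hso i
      exact he.exists_sSeg hset.2.2.2.2.2.2.1 hG hN (hQs.2.1 i) hc
    · simp only [restrictTo_eq_some, exists_and_right, ← hQs.mem_nodes_iff]
      exact ⟨fun h => ⟨(he.1 v).1 (Option.isSome_iff_exists.2 ⟨a, h⟩), h⟩, And.right⟩
  · rintro ⟨f, -, hf, he⟩
    choose j hj using hf
    exact .of_isJoin hQs (fun i => sSeg_subset G N (j i)) hj he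

end RDF
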